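/- Let I be an open interval whose closure is contained in (0,1), and let α ∈ Homeo⁺[0,1], α ≠ id, with Supp(α) ⊆ I. For every ε > 0 and all x, y ∈ (0,1) with x < y, there exist n ∈ ℕ and elements g₁,…,g_n ∈ F such that: (1) for some l₁,…,l_n ∈ ℤ, the element h = (α^{g₁})^{l₁}⋯(α^{g_n})^{l_n} satisfies x·h > y; and (2) for every β ∈ Homeo⁺[0,1] with Supp(β) ⊆ I and for all l₁,…,l_n ∈ ℤ, the homeomorphism (β^{g₁})^{l₁}⋯(β^{g_n})^{l_n} is ε-advancing, i.e. z·(β^{g₁})^{l₁}⋯(β^{g_n})^{l_n} ≥ z − ε for all z ∈ [0,1]. -/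

import Mathlib

open Set

noncomputable section

/-- The dyadic rationals `ℤ[1/2]` inside `ℝ`. -/
def DyadicRat : Set ℝ := {x : ℝ | ∃ (a : ℤ) (k : ℕ), x = a / 2 ^ k}

/-- Thompson's group `F`, realised as the set of increasing bijections of `[0,1]` that
are piecewise linear with finitely many breakpoints, all at dyadic rationals, and all
slopes integer powers of `2`. -/
def ThompsonF : Set (Equiv.Perm ↥(Set.Icc (0 : ℝ) 1)) :=
  {g | StrictMono ⇑g ∧
    ∃ (k : ℕ) (a : Fin (k + 1) → ℝ), StrictMono a ∧ a 0 = 0 ∧ a (Fin.last k) = 1 ∧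
      (∀ i, a i ∈ DyadicRat) ∧
      ∀ i : Fin k, ∃ (m : ℤ) (c : ℝ), ∀ x : ↥(Set.Icc (0 : ℝ) 1),
        (x : ℝ) ∈ Set.Icc (a i.castSucc) (a i.succ) →
          ((g x : ℝ)) = 2 ^ m * (x : ℝ) + c}

/-- `rword [w₁, …, w_k]` is the homeomorphism given by the word `w₁w₂⋯w_k` in the
right-action convention: apply `w₁` first, then `w₂`, and so on. -/
def rword (ws : List (Equiv.Perm ↥(Set.Icc (0 : ℝ) 1))) : Equiv.Perm ↥(Set.Icc (0 : ℝ) 1) :=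
  ws.reverse.prod

lemma dyadicRat_add {x y : ℝ} (hx : x ∈ DyadicRat) (hy : y ∈ DyadicRat) : x + y ∈ DyadicRat := by
  obtain ⟨m, k, rfl⟩ := hx
  obtain ⟨n, l, rfl⟩ := hy
  refine ⟨m * 2 ^ l + n * 2 ^ k, k + l, ?_⟩
  push_cast
  field_simp
  ring

lemma dyadicRat_sub {x y : ℝ} (hx : x ∈ DyadicRat) (hy : y ∈ DyadicRat) : x - y ∈ DyadicRat := by
  obtain ⟨n, l, rfl⟩ := hy
  have := dyadicRat_add hx ⟨-n, l, rfl⟩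
  convert this using 1
  push_cast
  ring

lemma dyadicRat_exists_nat_of_pos {x : ℝ} (hx : x ∈ DyadicRat) (h : 0 < x) :
    ∃ A k : ℕ, 0 < A ∧ x = A / 2 ^ k := by
  obtain ⟨m, k, rfl⟩ := hx
  have hm : (0 : ℝ) < m := by
    by_contra! hm
    exact absurd h (not_lt.2 (div_nonpos_of_nonpos_of_nonneg hm (by positivity)))
  have hm' : 0 < m := by exact_mod_cast hm
  lift m to ℕ using hm'.le
  exact ⟨m, k, by exact_mod_cast hm', by simp⟩

lemma exists_dyadicRat_between {x y : ℝ} (h : x < y) : ∃ z ∈ DyadicRat, x < z ∧ z < y := by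
  obtain ⟨k, hk⟩ := pow_unbounded_of_one_lt (1 / (y - x)) (one_lt_two (α := ℝ))
  have hpos : (0 : ℝ) < 2 ^ k := by positivity
  have hk' : 1 < 2 ^ k * (y - x) := by
    rwa [div_lt_iff₀ (sub_pos.2 h)] at hk
  refine ⟨(⌊2 ^ k * x⌋ + 1 : ℤ) / 2 ^ k, ⟨_, k, rfl⟩, ?_, ?_⟩
  · rw [lt_div_iff₀ hpos]
    push_cast
    linarith [Int.lt_floor_add_one (2 ^ k * x)]
  · rw [div_lt_iff₀ hpos]
    push_cast
    linarith [Int.floor_le (2 ^ k * x)]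

/-- `f` is piecewise linear on `[s, t]`, with dyadic breakpoints (including `s` and `t`) and slopes
integer powers of `2`. -/
inductive DyadicPL (f : ℝ → ℝ) : ℝ → ℝ → Prop
  | nil {s : ℝ} : s ∈ DyadicRat → DyadicPL f s s
  | cons {s t r : ℝ} (m : ℤ) (c : ℝ) : s ∈ DyadicRat → s < t →
      (∀ x ∈ Icc s t, f x = 2 ^ m * x + c) → DyadicPL f t r → DyadicPL f s r

namespace DyadicPL

variable {f g : ℝ → ℝ} {s t r : ℝ}

lemma le (h : DyadicPL f s t) : s ≤ t := by
  induction h with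
  | nil => exact le_rfl
  | cons m c hs hst hf _ ih => exact hst.le.trans ih

lemma trans (h : DyadicPL f s t) (h' : DyadicPL f t r) : DyadicPL f s r := by
  induction h with
  | nil => exact h'
  | cons m c hs hst hf _ ih => exact cons m c hs hst hf (ih h')

lemma congr (h : DyadicPL f s t) (hfg : EqOn g f (Icc s t)) : DyadicPL g s t := by
  induction h with
  | nil hs => exact nil hs
  | cons m c hs hst hf h ih =>
    refine cons m c hs hst (fun x hx => ?_) (ih (hfg.mono (Icc_subset_Icc_left hst.le)))
    rw [hfg (Icc_subset_Icc_right h.le hx), hf x hx]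

lemma strictMonoOn (h : DyadicPL f s t) : StrictMonoOn f (Icc s t) := by
  induction h with
  | nil => simp
  | cons m c hs hst hf h ih =>
    rw [← Icc_union_Icc_eq_Icc hst.le h.le]
    refine StrictMonoOn.union (fun x hx y hy hxy => ?_) ih (isGreatest_Icc hst.le)
      (isLeast_Icc h.le)
    rw [hf x hx, hf y hy]
    have : (0 : ℝ) < 2 ^ m := by positivity
    nlinarith

lemma continuousOn (h : DyadicPL f s t) : ContinuousOn f (Icc s t) := by
  induction h with
  | nil => simp
  | cons m c hs hst hf h ih =>
    rw [← Icc_union_Icc_eq_Icc hst.le h.le]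
    refine ContinuousOn.union_of_isClosed ?_ ih isClosed_Icc isClosed_Icc
    exact ContinuousOn.congr (by fun_prop) hf

lemma exists_partition (h : DyadicPL f s t) :
    ∃ (k : ℕ) (a : Fin (k + 1) → ℝ), StrictMono a ∧ a 0 = s ∧ a (Fin.last k) = t ∧
      (∀ i, a i ∈ DyadicRat) ∧
      ∀ i : Fin k, ∃ (m : ℤ) (c : ℝ), ∀ x ∈ Icc (a i.castSucc) (a i.succ),
        f x = 2 ^ m * x + c := by
  induction h with
  | @nil s hs => exact ⟨0, fun _ => s, fun i j h => by omega, rfl, rfl, fun _ => hs, nofun⟩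
  | @cons s t r m c hs hst hf h ih =>
    obtain ⟨k, a, ha, ha0, hal, had, haf⟩ := ih
    refine ⟨k + 1, Fin.cons s a, ?_, rfl, ?_, ?_, ?_⟩
    · rw [Fin.strictMono_iff_lt_succ]
      intro i
      cases i using Fin.cases with
      | zero => simpa [ha0] using hst
      | succ i => simpa [← Fin.succ_castSucc] using ha i.castSucc_lt_succ
    · rw [← Fin.succ_last, Fin.cons_succ, hal]
    · intro i
      cases i using Fin.cases with
      | zero => simpa using hs
      | succ i => simpa using had i
    · intro i
      cases i using Fin.cases with
      | zero => exact ⟨m, c, by simpa [ha0] using hf⟩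
      | succ i => simpa [← Fin.succ_castSucc] using haf i

lemma exists_glue (hf : DyadicPL f s t) (hg : DyadicPL g t r) (hfg : f t = g t) :
    ∃ h, DyadicPL h s r ∧ EqOn h f (Icc s t) ∧ EqOn h g (Icc t r) := by
  have h1 : EqOn (fun x => if x ≤ t then f x else g x) f (Icc s t) := fun x hx => if_pos hx.2
  have h2 : EqOn (fun x => if x ≤ t then f x else g x) g (Icc t r) := by
    intro x hx
    dsimp only
    split_ifs with hxt
    · rw [le_antisymm hxt hx.1, hfg]
    · rfl
  exact ⟨_, (hf.congr h1).trans (hg.congr h2), h1, h2⟩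

lemma exists_of_nat (n : ℕ) : ∀ A B : ℕ, A + B = n → 0 < A → 0 < B → ∀ (k l : ℕ) (s s' : ℝ),
    s ∈ DyadicRat →
      ∃ f, DyadicPL f s (s + A / 2 ^ k) ∧ f s = s' ∧ f (s + A / 2 ^ k) = s' + B / 2 ^ l := by
  induction n using Nat.strong_induction_on with
  | _ n ih =>
  rintro A B rfl hA hB k l s s' hs
  have unit (k l : ℕ) (s s' : ℝ) (hs : s ∈ DyadicRat) :
      ∃ f, DyadicPL f s (s + 1 / 2 ^ k) ∧ f s = s' ∧ f (s + 1 / 2 ^ k) = s' + 1 / 2 ^ l := by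
    refine ⟨fun x => 2 ^ ((k : ℤ) - l) * x + (s' - 2 ^ ((k : ℤ) - l) * s),
      cons _ _ hs (by simp) (fun _ _ => rfl) (nil (dyadicRat_add hs ⟨1, k, by simp⟩)), by ring, ?_⟩
    dsimp only
    rw [zpow_sub₀ two_ne_zero, zpow_natCast, zpow_natCast]
    field_simp
    ring
  have step (A B k' l' : ℕ) (x x' : ℝ) (hx : x = 1 / 2 ^ k' + (A : ℝ) / 2 ^ k')
      (hx' : x' = 1 / 2 ^ l' + (B : ℝ) / 2 ^ l')
      (h : ∃ f, DyadicPL f (s + 1 / 2 ^ k') (s + 1 / 2 ^ k' + A / 2 ^ k') ∧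
        f (s + 1 / 2 ^ k') = s' + 1 / 2 ^ l' ∧
        f (s + 1 / 2 ^ k' + A / 2 ^ k') = s' + 1 / 2 ^ l' + B / 2 ^ l') :
      ∃ f, DyadicPL f s (s + x) ∧ f s = s' ∧ f (s + x) = s' + x' := by
    obtain ⟨f, hf, hf0, hf1⟩ := unit k' l' s s' hs
    obtain ⟨g, hg, hg0, hg1⟩ := h
    obtain ⟨F, hF, hFf, hFg⟩ := exists_glue hf hg (by rw [hf1, hg0])
    subst hx hx'
    rw [← add_assoc, ← add_assoc]
    exact ⟨F, hF, by rw [hFf (left_mem_Icc.2 hf.le), hf0],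
      by rw [hFg (right_mem_Icc.2 hg.le), hg1]⟩
  have hd (k : ℕ) : s + 1 / 2 ^ k ∈ DyadicRat := dyadicRat_add hs ⟨1, k, by simp⟩
  obtain ⟨A, rfl⟩ : ∃ A', A = A' + 1 := ⟨A - 1, by omega⟩
  obtain ⟨B, rfl⟩ : ∃ B', B = B' + 1 := ⟨B - 1, by omega⟩
  rcases Nat.eq_zero_or_pos A with rfl | hA' <;> rcases Nat.eq_zero_or_pos B with rfl | hB'
  · simpa using unit k l s s' hs
  · refine step 1 B (k + 1) l _ _ ?_ ?_ (ih (1 + B) (by omega) 1 B rfl one_pos hB' _ _ _ _ (hd _))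
    · push_cast; field_simp; ring
    · push_cast; ring
  · refine step A 1 k (l + 1) _ _ ?_ ?_ (ih (A + 1) (by omega) A 1 rfl hA' one_pos _ _ _ _ (hd _))
    · push_cast; ring
    · push_cast; field_simp; ring
  · refine step A B k l _ _ ?_ ?_ (ih (A + B) (by omega) A B rfl hA' hB' _ _ _ _ (hd _))
    · push_cast; ring
    · push_cast; ring

lemma exists_of_lt {s t s' t' : ℝ} (hs : s ∈ DyadicRat) (ht : t ∈ DyadicRat)
    (hs' : s' ∈ DyadicRat) (ht' : t' ∈ DyadicRat) (hst : s < t) (hst' : s' < t') :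
    ∃ f, DyadicPL f s t ∧ f s = s' ∧ f t = t' := by
  obtain ⟨A, k, hA, hAk⟩ := dyadicRat_exists_nat_of_pos (dyadicRat_sub ht hs) (sub_pos.2 hst)
  obtain ⟨B, l, hB, hBl⟩ := dyadicRat_exists_nat_of_pos (dyadicRat_sub ht' hs') (sub_pos.2 hst')
  have := exists_of_nat _ A B rfl hA hB k l s s' hs
  rwa [← hAk, ← hBl, add_sub_cancel, add_sub_cancel] at this

lemma exists_thompsonF (h : DyadicPL f 0 1) (h0 : f 0 = 0) (h1 : f 1 = 1) :
    ∃ g ∈ ThompsonF, ∀ x, (g x : ℝ) = f x := by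
  have hm := h.strictMonoOn
  have hmaps (x : Icc (0 : ℝ) 1) : f x ∈ Icc (0 : ℝ) 1 := by
    constructor
    · exact h0.ge.trans (hm.monotoneOn (left_mem_Icc.2 zero_le_one) x.2 x.2.1)
    · exact (hm.monotoneOn x.2 (right_mem_Icc.2 zero_le_one) x.2.2).trans h1.le
  let F : Icc (0 : ℝ) 1 → Icc (0 : ℝ) 1 := fun x => ⟨f x, hmaps x⟩
  have hF : StrictMono F := fun x y hxy => hm x.2 y.2 hxy
  have hsurj : Function.Surjective F := by
    intro y
    obtain ⟨x, hx, hxy⟩ := intermediate_value_Icc zero_le_one h.continuousOn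
      (by rw [h0, h1]; exact y.2)
    exact ⟨⟨x, hx⟩, Subtype.ext hxy⟩
  refine ⟨Equiv.ofBijective F ⟨hF.injective, hsurj⟩, ⟨hF, ?_⟩, fun x => rfl⟩
  obtain ⟨k, a, ha, ha0, hal, had, haf⟩ := h.exists_partition
  refine ⟨k, a, ha, ha0, hal, had, fun i => ?_⟩
  obtain ⟨m, c, hmc⟩ := haf i
  exact ⟨m, c, fun x hx => hmc x hx⟩

end DyadicPL

lemma exists_thompsonF_of_dyadic {a c d b p u v q : ℝ} (ha : a ∈ DyadicRat) (hc : c ∈ DyadicRat)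
    (hd : d ∈ DyadicRat) (hb : b ∈ DyadicRat) (hp : p ∈ DyadicRat) (hu : u ∈ DyadicRat)
    (hv : v ∈ DyadicRat) (hq : q ∈ DyadicRat) (h0a : 0 < a) (hac : a < c) (hcd : c < d)
    (hdb : d < b) (hb1 : b < 1) (h0p : 0 < p) (hpu : p < u) (huv : u < v) (hvq : v < q)
    (hq1 : q < 1) :
    ∃ f, DyadicPL f 0 1 ∧ f 0 = 0 ∧ f a = p ∧ f c = u ∧ f d = v ∧ f b = q ∧ f 1 = 1 := by
  have d0 : (0 : ℝ) ∈ DyadicRat := ⟨0, 0, by simp⟩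
  have d1 : (1 : ℝ) ∈ DyadicRat := ⟨1, 0, by simp⟩
  obtain ⟨f₁, h₁, h₁l, h₁r⟩ := DyadicPL.exists_of_lt d0 ha d0 hp h0a h0p
  obtain ⟨f₂, h₂, h₂l, h₂r⟩ := DyadicPL.exists_of_lt ha hc hp hu hac hpu
  obtain ⟨f₃, h₃, h₃l, h₃r⟩ := DyadicPL.exists_of_lt hc hd hu hv hcd huv
  obtain ⟨f₄, h₄, h₄l, h₄r⟩ := DyadicPL.exists_of_lt hd hb hv hq hdb hvq
  obtain ⟨f₅, h₅, h₅l, h₅r⟩ := DyadicPL.exists_of_lt hb d1 hq d1 hb1 hq1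
  obtain ⟨g₂, k₂, e₂, e₂'⟩ := DyadicPL.exists_glue h₁ h₂ (by rw [h₁r, h₂l])
  obtain ⟨g₃, k₃, e₃, e₃'⟩ := DyadicPL.exists_glue k₂ h₃
    (by rw [e₂' ⟨hac.le, le_rfl⟩, h₂r, h₃l])
  obtain ⟨g₄, k₄, e₄, e₄'⟩ := DyadicPL.exists_glue k₃ h₄
    (by rw [e₃' ⟨hcd.le, le_rfl⟩, h₃r, h₄l])
  obtain ⟨g₅, k₅, e₅, e₅'⟩ := DyadicPL.exists_glue k₄ h₅
    (by rw [e₄' ⟨hdb.le, le_rfl⟩, h₄r, h₅l])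
  refine ⟨g₅, k₅, ?_, ?_, ?_, ?_, ?_, ?_⟩
  · rw [e₅ ⟨by linarith, by linarith⟩, e₄ ⟨by linarith, by linarith⟩,
      e₃ ⟨by linarith, by linarith⟩, e₂ ⟨by linarith, by linarith⟩, h₁l]
  · rw [e₅ ⟨by linarith, by linarith⟩, e₄ ⟨by linarith, by linarith⟩,
      e₃ ⟨by linarith, by linarith⟩, e₂ ⟨by linarith, by linarith⟩, h₁r]
  · rw [e₅ ⟨by linarith, by linarith⟩, e₄ ⟨by linarith, by linarith⟩,
      e₃ ⟨by linarith, by linarith⟩, e₂' ⟨by linarith, by linarith⟩, h₂r]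
  · rw [e₅ ⟨by linarith, by linarith⟩, e₄ ⟨by linarith, by linarith⟩,
      e₃' ⟨by linarith, by linarith⟩, h₃r]
  · rw [e₅ ⟨by linarith, by linarith⟩, e₄' ⟨by linarith, by linarith⟩, h₄r]
  · rw [e₅' ⟨by linarith, by linarith⟩, h₅r]

/-- Elements of `F` send any four points approximately onto any other four points. -/
lemma exists_thompsonF_approx {a c d b : Icc (0 : ℝ) 1} {p u v q : ℝ} (h0a : (0 : ℝ) < a)
    (hac : a < c) (hcd : c < d) (hdb : d < b) (hb1 : (b : ℝ) < 1) (h0p : 0 < p) (hpu : p < u)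
    (huv : u < v) (hvq : v < q) (hq1 : q < 1) :
    ∃ g ∈ ThompsonF, p ≤ g a ∧ (g c : ℝ) ≤ u ∧ v ≤ g d ∧ (g b : ℝ) ≤ q := by
  have hac' : (a : ℝ) < c := hac
  have hcd' : (c : ℝ) < d := hcd
  have hdb' : (d : ℝ) < b := hdb
  obtain ⟨a', ha', h0a', haa'⟩ := exists_dyadicRat_between h0a
  obtain ⟨c', hc', hcc', hcd₁⟩ := exists_dyadicRat_between hcd'
  obtain ⟨d', hd', hcd₂, hdd'⟩ := exists_dyadicRat_between hcd₁
  obtain ⟨b', hb', hbb', hb1'⟩ := exists_dyadicRat_between hb1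
  obtain ⟨p', hp', hpp', hpu'⟩ := exists_dyadicRat_between hpu
  obtain ⟨u', hu', hpu₂, huu'⟩ := exists_dyadicRat_between hpu'
  obtain ⟨v', hv', hvv', hvq'⟩ := exists_dyadicRat_between hvq
  obtain ⟨q', hq', hvq₂, hqq'⟩ := exists_dyadicRat_between hvq'
  obtain ⟨f, hf, hf0, hfa, hfc, hfd, hfb, hf1⟩ := exists_thompsonF_of_dyadic ha' hc' hd' hb' hp'
    hu' hv' hq' h0a' (by linarith) hcd₂ (by linarith) hb1' (by linarith) hpu₂ (by linarith) hvq₂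
    (by linarith)
  obtain ⟨g, hg, hgf⟩ := hf.exists_thompsonF hf0 hf1
  have hm := hf.strictMonoOn.monotoneOn
  refine ⟨g, hg, ?_, ?_, ?_, ?_⟩ <;> rw [hgf]
  · have := hm ⟨h0a'.le, by linarith⟩ a.2 haa'.le
    linarith
  · have := hm c.2 ⟨by linarith, by linarith⟩ hcc'.le
    linarith
  · have := hm ⟨by linarith, by linarith⟩ d.2 hdd'.le
    linarith
  · have := hm b.2 ⟨by linarith, by linarith⟩ hbb'.le
    linarith

lemma rword_cons (w : Equiv.Perm (Icc (0 : ℝ) 1)) (ws : List (Equiv.Perm (Icc (0 : ℝ) 1)))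
    (z : Icc (0 : ℝ) 1) : rword (w :: ws) z = rword ws (w z) := by
  simp [rword]

lemma le_rword_ofFn_of_step {k : ℕ} (w : Fin k → Equiv.Perm (Icc (0 : ℝ) 1)) (u : ℕ → ℝ)
    (hw : ∀ (i : Fin k) (z : Icc (0 : ℝ) 1), u i ≤ (z : ℝ) → u (i + 1) ≤ (w i z : ℝ)) (z : Icc (0 : ℝ) 1) (hz : u 0 ≤ z) :
    u k ≤ rword (List.ofFn w) z := by
  induction k generalizing u z with
  | zero => simpa [rword] using hz
  | succ k ih =>
    rw [List.ofFn_succ, rword_cons]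
    exact ih _ (fun i => u (i + 1)) (fun (i : Fin k) z hz => by simpa using hw i.succ z (by simpa using hz)) _
      (by simpa using hw 0 z (by simpa using hz))

lemma sub_le_rword_ofFn {k : ℕ} (w : Fin k → Equiv.Perm (Icc (0 : ℝ) 1)) (p : Fin k → ℝ)
    (hp : Monotone p) (ε : ℝ) (hε : 0 ≤ ε)
    (hw : ∀ (i : Fin k) z, w i z ≠ z → (z : ℝ) ≤ p i + ε ∧ p i ≤ (w i z : ℝ)) (z : Icc (0 : ℝ) 1) :
    (z : ℝ) - ε ≤ rword (List.ofFn w) z := by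
  induction k generalizing z with
  | zero => simpa [rword] using hε
  | succ k ih =>
    rw [List.ofFn_succ, rword_cons]
    by_cases h : w 0 z = z
    · rw [h]
      exact ih _ (fun i => p i.succ) (fun i j hij => hp (Fin.succ_le_succ_iff.2 hij))
        (fun i z => hw i.succ z) z
    · obtain ⟨h1, h2⟩ := hw 0 z h
      refine le_trans (by linarith) (le_rword_ofFn_of_step _ (fun _ => p 0)
        (fun (i : Fin k) (y : Icc (0 : ℝ) 1) hy => ?_) _ h2)
      by_cases hi : w i.succ y = y
      · rwa [hi]
      · exact (hp (Fin.zero_le _)).trans (hw i.succ y hi).2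

lemma zpow_apply_mem_of_support_subset {X : Type*} {σ : Equiv.Perm X} {J : Set X}
    (h : ∀ z, σ z ≠ z → z ∈ J) (l : ℤ) {z : X} (hz : z ∈ J) : (σ ^ l) z ∈ J := by
  by_contra hw
  have h1 : σ ((σ ^ l) z) = (σ ^ l) z := by
    by_contra h2
    exact hw (h _ h2)
  have h2 := (σ ^ l).injective (Equiv.Perm.zpow_apply_eq_self_of_apply_eq_self h1 l)
  exact hw (h2.symm ▸ hz)

lemma mem_of_zpow_apply_ne {X : Type*} {σ : Equiv.Perm X} {J : Set X}
    (h : ∀ z, σ z ≠ z → z ∈ J) (l : ℤ) {z : X} (hz : (σ ^ l) z ≠ z) : z ∈ J := by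
  refine h z fun h1 => hz ?_
  exact Equiv.Perm.zpow_apply_eq_self_of_apply_eq_self h1 l

lemma exists_lt_zpow_apply {X : Type*} [LinearOrder X] {σ : Equiv.Perm X} (hσ : StrictMono σ)
    (h1 : σ ≠ 1) : ∃ (l : ℤ) (c : X), c < (σ ^ l) c ∧ StrictMono ⇑(σ ^ l) := by
  obtain ⟨x, hx⟩ : ∃ x, σ x ≠ x := by
    by_contra! h
    exact h1 (Equiv.ext h)
  rcases lt_or_gt_of_ne hx with h | h
  · refine ⟨-1, σ x, by simpa using h, fun y z hyz => ?_⟩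
    rw [← hσ.lt_iff_lt]
    simpa using hyz
  · exact ⟨1, x, by simpa using h, by simpa using hσ⟩

/-- Lemma 2.12 of the paper. Given a nontrivial
`α ∈ Homeo⁺[0,1]` supported in an open interval `I = (a,b)` with closure in `(0,1)`,
`ε > 0` and `x < y` in `(0,1)`, there are `g₁, …, g_k ∈ F` such that some product
`(α^{g₁})^{l₁}⋯(α^{g_k})^{l_k}` moves `x` above `y`, while for *any* `β` supported in
`I` and any exponents, the corresponding product is `ε`-advancing.
(Conjugation in the right-action convention: `α^g = g⁻¹αg` applies `g⁻¹`, then `α`,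
then `g`, which is the permutation `g * α * g⁻¹` in the left-composition convention.) -/
theorem stmt_12 (a b : ℝ) (ha : 0 < a) (hab : a < b) (hb : b < 1)
    (α : Equiv.Perm ↥(Set.Icc (0 : ℝ) 1)) (hαmono : StrictMono ⇑α) (hα : α ≠ 1)
    (hαsupp : ∀ p : ↥(Set.Icc (0 : ℝ) 1), α p ≠ p → (p : ℝ) ∈ Set.Ioo a b)
    (ε : ℝ) (hε : 0 < ε)
    (x y : ↥(Set.Icc (0 : ℝ) 1)) (hx : (x : ℝ) ∈ Set.Ioo (0 : ℝ) 1)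
    (hy : (y : ℝ) ∈ Set.Ioo (0 : ℝ) 1) (hxy : x < y) :
    ∃ (k : ℕ) (g : Fin k → Equiv.Perm ↥(Set.Icc (0 : ℝ) 1)),
      (∀ i, g i ∈ ThompsonF) ∧
      (∃ lvec : Fin k → ℤ,
        y < rword ((List.finRange k).map fun i => (g i * α * (g i)⁻¹) ^ lvec i) x) ∧
      (∀ β : Equiv.Perm ↥(Set.Icc (0 : ℝ) 1), StrictMono ⇑β →
        (∀ p : ↥(Set.Icc (0 : ℝ) 1), β p ≠ p → (p : ℝ) ∈ Set.Ioo a b) →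
        ∀ lvec : Fin k → ℤ, ∀ z : ↥(Set.Icc (0 : ℝ) 1),
          (z : ℝ) - ε ≤
            ((rword ((List.finRange k).map fun i => (g i * β * (g i)⁻¹) ^ lvec i) z : ℝ))) := by
  obtain ⟨l, c, hcd, hmono⟩ := exists_lt_zpow_apply hαmono hα
  have hc := mem_of_zpow_apply_ne (J := {p : Icc (0 : ℝ) 1 | (p : ℝ) ∈ Ioo a b}) hαsupp l hcd.ne'
  have hd := zpow_apply_mem_of_support_subset (J := {p : Icc (0 : ℝ) 1 | (p : ℝ) ∈ Ioo a b}) hαsupp l hc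
  obtain ⟨y', hyy', hy'1⟩ := exists_between hy.2
  have hxy' : (x : ℝ) < y' := lt_trans hxy hyy'
  obtain ⟨k, hk⟩ := exists_nat_gt ((y' - x) / min (ε / 3) (min x (1 - y')))
  have hmin : 0 < min (ε / 3) (min (x : ℝ) (1 - y')) :=
    lt_min (by positivity) (lt_min hx.1 (by linarith))
  have hk0 : (0 : ℝ) < k := lt_trans (div_pos (by linarith) hmin) hk
  rw [div_lt_comm₀ hmin hk0, lt_min_iff, lt_min_iff] at hk
  obtain ⟨δ, hδ⟩ : ∃ δ, δ = (y' - x) / k := ⟨_, rfl⟩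
  rw [← hδ] at hk
  obtain ⟨hδε, hδx, hδy⟩ := hk
  have hδ0 : 0 < δ := hδ ▸ div_pos (by linarith) hk0
  have hkδ : (x : ℝ) + k * δ = y' := by rw [hδ]; field_simp; ring
  let A : Icc (0 : ℝ) 1 := ⟨a, ha.le, by linarith⟩
  let B : Icc (0 : ℝ) 1 := ⟨b, by linarith, hb.le⟩
  have key (i : Fin k) : ∃ g ∈ ThompsonF, (x : ℝ) + (i : ℕ) * δ - δ ≤ g A ∧ (g c : ℝ) ≤ x + (i : ℕ) * δ ∧
      (x : ℝ) + (i : ℕ) * δ + δ ≤ g ((α ^ l) c) ∧ (g B : ℝ) ≤ x + (i : ℕ) * δ + δ + δ := by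
    have hi : ((i : ℕ) : ℝ) + 1 ≤ k := by exact_mod_cast i.2
    have hi0 : 0 ≤ ((i : ℕ) : ℝ) * δ := by positivity
    have hi1 : (((i : ℕ) : ℝ) + 1) * δ ≤ k * δ := by gcongr
    exact exists_thompsonF_approx (a := A) (b := B) ha hc.1 hcd hd.2 hb (by linarith)
      (by linarith) (by linarith) (by linarith) (by linarith)
  choose g hgF hgA hgc hgd hgB using key
  refine ⟨k, g, hgF, ⟨fun _ => l, ?_⟩, fun β _ hβ lvec z => ?_⟩ <;> rw [← List.ofFn_eq_map]
  · refine Subtype.coe_lt_coe.1 (hyy'.trans_le ?_)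
    rw [← hkδ]
    refine le_rword_ofFn_of_step _ (fun i => x + i * δ) (fun i z hz => ?_) x (by simp)
    have h1 : c ≤ (g i)⁻¹ z := by
      rw [← (hgF i).1.le_iff_le, Equiv.Perm.inv_def, Equiv.apply_symm_apply]
      exact (hgc i).trans hz
    have h2 : (g i ((α ^ l) c) : ℝ) ≤ g i ((α ^ l) ((g i)⁻¹ z)) :=
      (hgF i).1.monotone (hmono.monotone h1)
    rw [conj_zpow, Equiv.Perm.mul_apply, Equiv.Perm.mul_apply]
    push_cast
    linarith [hgd i]
  · refine sub_le_rword_ofFn _ (fun i => x + i * δ - δ) (fun i j hij => ?_) ε hε.le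
      (fun i z hz => ?_) z
    · have : ((i : ℕ) : ℝ) ≤ (j : ℕ) := by exact_mod_cast hij
      dsimp only
      gcongr
    · have hsupp : ∀ z, (g i * β * (g i)⁻¹) z ≠ z → z ∈ Ioo (g i A) (g i B) := by
        intro z hz
        have h := hβ ((g i)⁻¹ z) fun h => hz (by
          rw [Equiv.Perm.mul_apply, Equiv.Perm.mul_apply, h, Equiv.Perm.inv_def, Equiv.apply_symm_apply])
        have h1 : A < (g i)⁻¹ z := h.1
        have h2 : (g i)⁻¹ z < B := h.2
        rw [← (hgF i).1.lt_iff_lt, Equiv.Perm.inv_def, Equiv.apply_symm_apply] at h1 h2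
        exact ⟨h1, h2⟩
      have h1 := mem_of_zpow_apply_ne hsupp _ hz
      have h2 : (g i A : ℝ) < _ := (zpow_apply_mem_of_support_subset hsupp (lvec i) h1).1
      have h3 : (z : ℝ) < g i B := h1.2
      exact ⟨by linarith [hgB i], by linarith [hgA i]⟩
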